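/- Let α, β > 0 and let x ∈ (0,1). For each N > max(α,β), consider the two-state Markov chain with transition probabilities α_N = α/N and β_N = β/N, and let Pr_N(n_g = m, s_N = d | s_0 = c) denote the corresponding occupancy probabilities. If (m_N) is a sequence of integers with 0 ≤ m_N ≤ N and m_N/N → x, then lim_{N→∞} N · Pr_N(n_g = m_N, s_N = g | s_0 = b) = β e^{−αx−β(1−x)} ∑_{k=0}^∞ (αβ x(1−x))^k / (k!)^2 (the series equals I_0(2√(αβx(1−x))), the modified Bessel function of order 0). -/

import Mathlib

open scoped Classical
open Finset Filter

/-- One step of the two-state Gilbert-Elliott Markov chain on `Bool`, where `true`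
is the good state `g` and `false` is the bad state `b`:
`P(b|g) = a`, `P(g|g) = 1−a`, `P(g|b) = b`, `P(b|b) = 1−b`. -/
noncomputable def geStep (a b : ℝ) (c d : Bool) : ℝ :=
  if c then (if d then 1 - a else a) else (if d then b else 1 - b)

/-- Probability of the trajectory `(t 0, t 1, …, t N)` given its initial state:
`∏_{n=0}^{N-1} P(t (n+1) | t n)`. -/
noncomputable def geTrajProb (a b : ℝ) (N : ℕ) (t : Fin (N + 1) → Bool) : ℝ :=
  ∏ n : Fin N, geStep a b (t n.castSucc) (t n.succ)

/-- `Pr(n_g = m, s_N = d | s_0 = c)`: the sum of trajectory probabilities over all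
trajectories `(s_0, …, s_N)` with `s_0 = c`, `s_N = d`, and exactly `m` indices
`n ∈ {0, …, N−1}` with `s_n = g` (`g = true`). -/
noncomputable def prOcc (a b : ℝ) (N m : ℕ) (c d : Bool) : ℝ :=
  ∑ t : Fin (N + 1) → Bool,
    if t 0 = c ∧ t (Fin.last N) = d ∧
        (Finset.univ.filter fun n : Fin N => t n.castSucc = true).card = m
      then geTrajProb a b N t else 0

theorem prOcc_eq_zero_of_lt (a b : ℝ) {N m : ℕ} (h : N < m) (c d : Bool) :
    prOcc a b N m c d = 0 := by
  refine Finset.sum_eq_zero fun t _ => if_neg ?_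
  rintro ⟨-, -, hcard⟩
  have := Finset.card_filter_le (Finset.univ : Finset (Fin N)) fun n => t n.castSucc = true
  rw [hcard, Finset.card_univ, Fintype.card_fin] at this
  omega

theorem prOcc_zero (a b : ℝ) (m : ℕ) (c d : Bool) :
    prOcc a b 0 m c d = if c = d ∧ m = 0 then 1 else 0 := by
  unfold prOcc
  rw [← (Equiv.funUnique (Fin 1) Bool).symm.sum_comp]
  rw [Fintype.sum_bool]
  cases c <;> cases d <;> simp [geTrajProb, eq_comm]

/-- First-step decomposition of the occupancy probabilities. -/
theorem prOcc_succ (a b : ℝ) (N m : ℕ) (c d : Bool) :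
    prOcc a b (N + 1) m c d = ∑ e : Bool, geStep a b c e *
      if c then (if m = 0 then 0 else prOcc a b N (m - 1) e d) else prOcc a b N m e d := by
  have hsum : ∀ (k : ℕ), (∑ e : Bool, geStep a b c e * prOcc a b N k e d) =
      ∑ t : Fin (N + 1) → Bool, if t (Fin.last N) = d ∧
        (Finset.univ.filter fun n : Fin N => t n.castSucc = true).card = k
      then geStep a b c (t 0) * geTrajProb a b N t else 0 := by
    intro k
    simp only [prOcc, Finset.mul_sum]
    rw [Finset.sum_comm]
    refine Finset.sum_congr rfl fun t _ => ?_
    rw [Finset.sum_eq_single (t 0)]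
    · simp
    · intro e _ he
      simp [he.symm]
    · simp
  have hcons : prOcc a b (N + 1) m c d = ∑ t : Fin (N + 1) → Bool,
      if t (Fin.last N) = d ∧ (if c then 1 else 0) +
        (Finset.univ.filter fun n : Fin N => t n.castSucc = true).card = m
      then geStep a b c (t 0) * geTrajProb a b N t else 0 := by
    rw [prOcc, ← (Fin.consEquiv fun _ : Fin (N + 2) => Bool).sum_comp, Fintype.sum_prod_type,
      Finset.sum_eq_single c]
    · refine Finset.sum_congr rfl fun t _ => ?_
      simp only [Fin.consEquiv_apply, Fin.cons_zero, geTrajProb, Fin.prod_univ_succ,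
        Fin.card_filter_univ_succ', ← Fin.succ_last, Fin.cons_succ, Fin.castSucc_zero,
        ← Fin.succ_castSucc, true_and]
    · intro e _ he
      refine Finset.sum_eq_zero fun t _ => if_neg ?_
      simp [he]
    · simp
  rw [hcons]
  cases c
  · simpa using (hsum m).symm
  · rcases m with _ | m
    · simp
    · simpa [add_comm 1] using (hsum m).symm

theorem prOcc_self_false_true (a b : ℝ) (m : ℕ) : prOcc a b m m false true = 0 := by
  cases m with
  | zero => simp [prOcc_zero]
  | succ m => simp [prOcc_succ, prOcc_eq_zero_of_lt]

theorem prOcc_false_succ (a b : ℝ) (N m : ℕ) :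
    prOcc a b (N + 1) m false true =
      (1 - b) * prOcc a b N m false true + b * prOcc a b N m true true := by
  simp [prOcc_succ, geStep, add_comm]

theorem prOcc_true_succ (a b : ℝ) (N m : ℕ) :
    prOcc a b (N + 1) (m + 1) true true =
      (1 - a) * prOcc a b N m true true + a * prOcc a b N m false true := by
  simp [prOcc_succ, geStep]

theorem prOcc_true_zero (a b : ℝ) (N : ℕ) : prOcc a b (N + 1) 0 true true = 0 := by
  simp [prOcc_succ]

theorem prOcc_self_true_true (a b : ℝ) (m : ℕ) : prOcc a b m m true true = (1 - a) ^ m := by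
  induction m with
  | zero => simp [prOcc_zero]
  | succ m ih => rw [prOcc_true_succ, ih, prOcc_self_false_true]; ring

/-- The probability of `k` successes in `n` independent trials of success probability `p`. -/
noncomputable def binomialWeight (p : ℝ) (n k : ℕ) : ℝ :=
  n.choose k * p ^ k * (1 - p) ^ (n - k)

theorem binomialWeight_eq_zero (p : ℝ) {n k : ℕ} (h : n < k) : binomialWeight p n k = 0 := by
  simp [binomialWeight, Nat.choose_eq_zero_of_lt h]

theorem binomialWeight_zero_right (p : ℝ) (n : ℕ) : binomialWeight p n 0 = (1 - p) ^ n := by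
  simp [binomialWeight]

theorem binomialWeight_succ_succ (p : ℝ) (n k : ℕ) :
    binomialWeight p (n + 1) (k + 1) =
      (1 - p) * binomialWeight p n (k + 1) + p * binomialWeight p n k := by
  rcases Nat.lt_or_ge n (k + 1) with h | h
  · rw [binomialWeight_eq_zero p h]
    simp only [binomialWeight, Nat.choose_succ_succ, Nat.choose_eq_zero_of_lt h,
      Nat.add_sub_add_right]
    push_cast
    ring
  · obtain ⟨j, rfl⟩ := Nat.exists_eq_add_of_le h
    have h1 : k + 1 + j + 1 - (k + 1) = j + 1 := by omega
    have h2 : k + 1 + j - (k + 1) = j := by omega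
    have h3 : k + 1 + j - k = j + 1 := by omega
    simp only [binomialWeight, Nat.choose_succ_succ (k + 1 + j) k, h1, h2, h3]
    push_cast
    ring

theorem prOcc_true_of_false (a b : ℝ) (K B : ℕ) (hB : B < K)
    (hF : ∀ m, prOcc a b (m + B + 1) m false true =
      b * ∑ k ∈ range (K + 1), binomialWeight a m k * binomialWeight b B k) (m : ℕ) :
    prOcc a b (m + B + 1) m true true =
      b * ∑ k ∈ range K, binomialWeight a m (k + 1) * binomialWeight b B k := by
  induction m with
  | zero =>
    rw [prOcc_true_zero, Finset.sum_eq_zero fun k _ => by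
      rw [binomialWeight_eq_zero a k.succ_pos, zero_mul], mul_zero]
  | succ m ih =>
    rw [show m + 1 + B + 1 = m + B + 1 + 1 by ring, prOcc_true_succ, ih, hF,
      Finset.sum_range_succ, binomialWeight_eq_zero b hB, mul_zero, add_zero, mul_left_comm,
      mul_left_comm a, ← mul_add, Finset.mul_sum, Finset.mul_sum, ← Finset.sum_add_distrib]
    congr 1
    refine Finset.sum_congr rfl fun k _ => ?_
    rw [binomialWeight_succ_succ]
    ring

theorem prOcc_eq_sum_binomialWeight (a b : ℝ) (K B : ℕ) (hB : B < K) (m : ℕ) :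
    prOcc a b (m + B + 1) m false true =
        b * ∑ k ∈ range (K + 1), binomialWeight a m k * binomialWeight b B k ∧
      prOcc a b (m + B + 1) m true true =
        b * ∑ k ∈ range K, binomialWeight a m (k + 1) * binomialWeight b B k := by
  induction B generalizing m with
  | zero =>
    have hF : ∀ m, prOcc a b (m + 0 + 1) m false true =
        b * ∑ k ∈ range (K + 1), binomialWeight a m k * binomialWeight b 0 k := by
      intro m
      rw [Finset.sum_range_succ', Finset.sum_eq_zero fun k _ => by
        rw [binomialWeight_eq_zero b k.succ_pos, mul_zero]]
      simp [prOcc_false_succ, prOcc_self_false_true, prOcc_self_true_true,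
        binomialWeight_zero_right]
    exact ⟨hF m, prOcc_true_of_false a b K 0 hB hF m⟩
  | succ B ih =>
    have hF : ∀ m, prOcc a b (m + (B + 1) + 1) m false true =
        b * ∑ k ∈ range (K + 1), binomialWeight a m k * binomialWeight b (B + 1) k := by
      intro m
      obtain ⟨h1, h2⟩ := ih (by omega) m
      rw [prOcc_false_succ, ← add_assoc, h1, h2, Finset.sum_range_succ', Finset.sum_range_succ']
      simp only [binomialWeight_succ_succ, binomialWeight_zero_right, mul_add,
        Finset.sum_add_distrib, Finset.mul_sum]
      have e1 : ∀ k, (1 - b) * (b * (binomialWeight a m (k + 1) * binomialWeight b B (k + 1))) =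
        b * (binomialWeight a m (k + 1) * ((1 - b) * binomialWeight b B (k + 1))) := by
        intro k; ring
      have e2 : ∀ k, b * (b * (binomialWeight a m (k + 1) * binomialWeight b B k)) =
        b * (binomialWeight a m (k + 1) * (b * binomialWeight b B k)) := by
        intro k; ring
      simp only [e1, e2]
      ring
    exact ⟨hF m, prOcc_true_of_false a b K (B + 1) hB hF m⟩

theorem prOcc_eq_tsum (a b : ℝ) (m B : ℕ) :
    prOcc a b (m + B + 1) m false true =
      b * ∑' k, binomialWeight a m k * binomialWeight b B k := by
  rw [(prOcc_eq_sum_binomialWeight a b (B + 1) B B.lt_succ_self m).1, tsum_eq_sum]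
  intro k hk
  rw [binomialWeight_eq_zero b (by simp at hk; omega), mul_zero]

theorem norm_binomialWeight_le {c : ℝ} (hc : 0 ≤ c) {N n : ℕ} (hcN : c ≤ N) (hn : n ≤ N) (k : ℕ) :
    ‖binomialWeight (c / N) n k‖ ≤ c ^ k / k.factorial := by
  have hp0 : 0 ≤ c / N := by positivity
  have hp1 : c / N ≤ 1 := div_le_one_of_le₀ hcN (by positivity)
  have hq0 : 0 ≤ 1 - c / N := by linarith
  have hq1 : (1 - c / N) ^ (n - k) ≤ 1 := pow_le_one₀ hq0 (by linarith)
  rw [binomialWeight, Real.norm_of_nonneg (by positivity)]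
  calc (n.choose k : ℝ) * (c / N) ^ k * (1 - c / N) ^ (n - k)
      ≤ n.choose k * (c / N) ^ k := mul_le_of_le_one_right (by positivity) hq1
    _ ≤ (N : ℝ) ^ k / k.factorial * (c / N) ^ k := by
      gcongr
      exact (Nat.choose_le_pow_div k n).trans (by gcongr)
    _ = (N * (c / N)) ^ k / k.factorial := by rw [mul_pow]; ring
    _ ≤ c ^ k / k.factorial := by
      gcongr
      rcases eq_or_ne (N : ℝ) 0 with h | h
      · simpa [h] using hc
      · exact (mul_div_cancel₀ c h).le

/-- Poisson limit for binomial weights along a sequence of trial counts `n N ∼ y N`. -/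
theorem tendsto_binomialWeight {c y : ℝ} (hy : 0 < y) {n : ℕ → ℕ}
    (hn : Tendsto (fun N : ℕ => (n N : ℝ) / N) atTop (nhds y)) (k : ℕ) :
    Tendsto (fun N : ℕ => binomialWeight (c / N) (n N) k) atTop
      (nhds ((c * y) ^ k / k.factorial * Real.exp (-(c * y)))) := by
  have hn_top : Tendsto n atTop atTop := by
    rw [← tendsto_natCast_atTop_iff (R := ℝ)]
    refine (hn.pos_mul_atTop hy tendsto_natCast_atTop_atTop).congr' ?_
    filter_upwards [eventually_ne_atTop 0] with N hN
    field_simp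
  have hchoose : Tendsto (fun N : ℕ => ((n N).choose k : ℝ) * (c / N) ^ k) atTop
      (nhds ((c * y) ^ k / k.factorial)) := by
    have hequiv := ((isEquivalent_choose k).comp_tendsto hn_top).mul
      (Asymptotics.IsEquivalent.refl (u := fun N : ℕ => (c / (N : ℝ)) ^ k))
    refine hequiv.symm.tendsto_nhds ?_
    refine (((hn.const_mul c).pow k).div_const (k.factorial : ℝ)).congr fun N => ?_
    simp only [Pi.mul_apply, Function.comp_apply, mul_pow, div_pow]
    ring
  have hsub : Tendsto (fun N : ℕ => ((n N - k : ℕ) : ℝ) / N) atTop (nhds y) := by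
    have h0 := hn.sub (tendsto_const_div_atTop_nhds_zero_nat (k : ℝ))
    rw [sub_zero] at h0
    refine h0.congr' ?_
    filter_upwards [hn_top.eventually_ge_atTop k] with N hN
    rw [Nat.cast_sub hN, sub_div]
  have hpow : Tendsto (fun N : ℕ => (1 - c / (N : ℝ)) ^ (n N - k)) atTop
      (nhds (Real.exp (-(c * y)))) := by
    have h := (Real.tendsto_one_add_div_pow_exp (-c)).rpow hsub (Or.inl (Real.exp_ne_zero _))
    rw [← Real.exp_mul, neg_mul] at h
    refine h.congr' ?_
    filter_upwards [eventually_ge_atTop ⌈c⌉₊, eventually_ne_atTop 0] with N hN hN0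
    have hcN : c / N ≤ 1 := div_le_one_of_le₀ (Nat.ceil_le.mp hN) (by positivity)
    have hq : 0 ≤ 1 - c / (N : ℝ) := by linarith
    rw [neg_div, ← sub_eq_add_neg, ← Real.rpow_natCast, ← Real.rpow_mul hq,
      mul_div_cancel₀ _ (Nat.cast_ne_zero.mpr hN0), Real.rpow_natCast]
  exact hchoose.mul hpow

/-- in the rare-transition regime (transition probabilities `α/N`, `β/N`),
if `m_N/N → x ∈ (0,1)` then
`N · Pr_N(n_g = m_N, s_N = g | s_0 = b) → β e^{−αx−β(1−x)} I_0(2√(αβx(1−x)))`,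
where `I_0(2√u) = ∑_k u^k/(k!)²` is the modified Bessel function of order 0. -/
theorem stmt_8 (α β x : ℝ) (hα : 0 < α) (hβ : 0 < β) (hx : x ∈ Set.Ioo (0 : ℝ) 1)
    (m : ℕ → ℕ) (hm : ∀ N, m N ≤ N)
    (hmx : Tendsto (fun N : ℕ => (m N : ℝ) / N) atTop (nhds x)) :
    Tendsto (fun N : ℕ => (N : ℝ) * prOcc (α / N) (β / N) N (m N) false true) atTop
      (nhds (β * Real.exp (-(α * x) - β * (1 - x)) *
        ∑' k : ℕ, (α * β * x * (1 - x)) ^ k / (k.factorial : ℝ) ^ 2)) := by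
  obtain ⟨hx0, hx1⟩ := hx
  have hlt : ∀ᶠ N : ℕ in atTop, m N < N := by
    filter_upwards [hmx.eventually_lt_const hx1, eventually_gt_atTop 0] with N h hN
    rw [div_lt_one (by exact_mod_cast hN)] at h
    exact_mod_cast h
  have hbad : Tendsto (fun N : ℕ => ((N - m N - 1 : ℕ) : ℝ) / N) atTop (nhds (1 - x)) := by
    have h := (hmx.const_sub 1).sub (tendsto_const_div_atTop_nhds_zero_nat (1 : ℝ))
    rw [sub_zero] at h
    refine h.congr' ?_
    filter_upwards [hlt] with N hN
    have hN0 : (N : ℝ) ≠ 0 := by norm_cast; omega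
    rw [Nat.cast_sub (by omega), Nat.cast_sub (hm N)]
    field_simp
    simp
  have hlim : Tendsto (fun N : ℕ => ∑' k, binomialWeight (α / N) (m N) k *
      binomialWeight (β / N) (N - m N - 1) k) atTop
      (nhds (∑' k : ℕ, (α * x) ^ k / k.factorial * Real.exp (-(α * x)) *
        ((β * (1 - x)) ^ k / k.factorial * Real.exp (-(β * (1 - x)))))) := by
    refine tendsto_tsum_of_dominated_convergence
      (bound := fun k => α ^ k / k.factorial * Real.exp β)
      ((Real.summable_pow_div_factorial α).mul_right _)
      (fun k => (tendsto_binomialWeight hx0 hmx k).mul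
        (tendsto_binomialWeight (sub_pos.mpr hx1) hbad k)) ?_
    filter_upwards [eventually_ge_atTop ⌈α⌉₊, eventually_ge_atTop ⌈β⌉₊] with N hαN hβN k
    rw [norm_mul]
    gcongr
    · exact norm_binomialWeight_le hα.le (Nat.ceil_le.mp hαN) (hm N) k
    · exact (norm_binomialWeight_le hβ.le (Nat.ceil_le.mp hβN) (by omega) k).trans
        (Real.pow_div_factorial_le_exp β hβ.le k)
  have hval : β * Real.exp (-(α * x) - β * (1 - x)) *
        ∑' k : ℕ, (α * β * x * (1 - x)) ^ k / (k.factorial : ℝ) ^ 2 =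
      β * ∑' k : ℕ, (α * x) ^ k / k.factorial * Real.exp (-(α * x)) *
        ((β * (1 - x)) ^ k / k.factorial * Real.exp (-(β * (1 - x)))) := by
    rw [mul_assoc, ← tsum_mul_left]
    congr 1
    refine tsum_congr fun k => ?_
    rw [sub_eq_add_neg, Real.exp_add, show α * β * x * (1 - x) = α * x * (β * (1 - x)) by ring,
      mul_pow (α * x)]
    ring
  rw [hval]
  refine (hlim.const_mul β).congr' ?_
  filter_upwards [hlt] with N hN
  have hN0 : (N : ℝ) ≠ 0 := by norm_cast; omega
  have h := prOcc_eq_tsum (α / N) (β / N) (m N) (N - m N - 1)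
  rw [show m N + (N - m N - 1) + 1 = N by omega] at h
  rw [h, ← mul_assoc, mul_div_cancel₀ _ hN0]
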